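/- Let X be a Banach space, M a bounded Borel subset of ℝ^d, F : D(F) ⊆ X → L¹(M), R : X → (−∞,∞] convex and lower semicontinuous, f† ∈ D(F) with g† := F(f†), f* ∈ ∂R(f†) a subgradient, and D the associated Bregman distance. Assume the noise model, let f̂_α be a Tikhonov estimator, and assume the variational source condition (r = 1) and the smoothing assumption with exponent q > 1 both hold at f = f̂_α. Then for every b > 1, setting η₀ := ((b−1)/(2b))·δ₀ and q' := q/(q−1), for all 0 < η ≤ η₀, ε ≥ 0 and α > 0: (1/b)·‖F(f̂_α) − g†‖_{L¹(M)} ≤ 4q'·ε + 2·(2η·γ((2b/(b−1))·η))^{q'}/(βα)^{q'−1} + 2αq'·ψ(2bα). -/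

import Mathlib

open MeasureTheory
open scoped ENNReal


lemma aux_young (K β α D q : ℝ) (hK : 0 ≤ K) (hβ : 0 < β) (hα : 0 < α) (hD : 0 ≤ D) (hq : 1 < q) :
    K * D ^ (1 / q) ≤ K ^ (q / (q - 1)) / (β * α) ^ (q / (q - 1) - 1) + β * α * D := by
  have hba : 0 < β * α := mul_pos hβ hα
  have hq1 : 0 < q - 1 := by linarith
  have hc : q.HolderConjugate (q / (q - 1)) := Real.HolderConjugate.conjExponent hq
  have hy := Real.young_inequality_of_nonneg (a := (β * α * D) ^ (1 / q))
    (b := K / (β * α) ^ (1 / q)) (by positivity) (by positivity) hc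
  have e1 : (β * α * D) ^ (1 / q) * (K / (β * α) ^ (1 / q)) = K * D ^ (1 / q) := by
    rw [Real.mul_rpow hba.le hD]
    have : 0 < (β * α) ^ (1 / q) := by positivity
    field_simp
  have e2 : ((β * α * D) ^ (1 / q)) ^ q = β * α * D := by
    rw [← Real.rpow_mul (by positivity), one_div_mul_cancel (by linarith), Real.rpow_one]
  have e3 : (K / (β * α) ^ (1 / q)) ^ (q / (q - 1))
      = K ^ (q / (q - 1)) / (β * α) ^ (q / (q - 1) - 1) := by
    rw [Real.div_rpow hK (by positivity), ← Real.rpow_mul hba.le]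
    congr 2
    field_simp
    ring
  rw [e1, e2, e3] at hy
  have h1 : β * α * D / q ≤ β * α * D := div_le_self (by positivity) hq.le
  have h2 : K ^ (q / (q - 1)) / (β * α) ^ (q / (q - 1) - 1) / (q / (q - 1))
      ≤ K ^ (q / (q - 1)) / (β * α) ^ (q / (q - 1) - 1) := by
    apply div_le_self (by positivity)
    rw [le_div_iff₀ hq1]; linarith
  linarith

lemma aux_split {E : Type*} [MeasurableSpace E] {μ : Measure E} {M Mc : Set E}
    (hMc : MeasurableSet Mc) (h : Mc ⊆ M) (u : E → ℝ) :
    eLpNorm u 1 (μ.restrict M) = eLpNorm u 1 (μ.restrict Mc) + eLpNorm u 1 (μ.restrict (M \ Mc)) := by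
  simp only [eLpNorm_one_eq_lintegral_enorm]
  rw [← lintegral_inter_add_sdiff _ M hMc, Set.inter_eq_right.mpr h]

lemma aux_mono {E : Type*} [MeasurableSpace E] {μ : Measure E} {M N : Set E}
    (h : N ⊆ M) (u : E → ℝ) (p : ℝ≥0∞) :
    eLpNorm u p (μ.restrict N) ≤ eLpNorm u p (μ.restrict M) :=
  eLpNorm_mono_measure _ (Measure.restrict_mono h le_rfl)

lemma aux_noise {E : Type*} [MeasurableSpace E] {μ : Measure E} {M Mc : Set E}
    (hMc : MeasurableSet Mc) (h : Mc ⊆ M) (u ξ : E → ℝ)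
    (hu : AEStronglyMeasurable u (μ.restrict M)) (hξ : AEStronglyMeasurable ξ (μ.restrict M))
    (hu1 : eLpNorm u 1 (μ.restrict M) ≠ ⊤) (hξ1 : eLpNorm ξ 1 (μ.restrict M) ≠ ⊤)
    (ε : ℝ) (hε : 0 ≤ ε) (ho : eLpNorm ξ 1 (μ.restrict (M \ Mc)) ≤ ENNReal.ofReal ε) :
    (eLpNorm ξ 1 (μ.restrict M)).toReal - (eLpNorm (u - ξ) 1 (μ.restrict M)).toReal
      ≤ 2 * ε - (eLpNorm u 1 (μ.restrict M)).toReal + 2 * (eLpNorm u 1 (μ.restrict Mc)).toReal := by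
  have hw1 : eLpNorm (u - ξ) 1 (μ.restrict M) ≠ ⊤ :=
    ((eLpNorm_sub_le hu hξ le_rfl).trans_lt (ENNReal.add_lt_top.2 ⟨hu1.lt_top, hξ1.lt_top⟩)).ne
  have hd : M \ Mc ⊆ M := Set.sdiff_subset
  have f1 := fun (v : E → ℝ) (hv : eLpNorm v 1 (μ.restrict M) ≠ ⊤) =>
    ne_top_of_le_ne_top hv (aux_mono (μ := μ) h v 1)
  have f2 := fun (v : E → ℝ) (hv : eLpNorm v 1 (μ.restrict M) ≠ ⊤) =>
    ne_top_of_le_ne_top hv (aux_mono (μ := μ) hd v 1)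
  have sp := fun (v : E → ℝ) (hv : eLpNorm v 1 (μ.restrict M) ≠ ⊤) => by
    have := congrArg ENNReal.toReal (aux_split (μ := μ) hMc h v)
    rw [ENNReal.toReal_add (f1 v hv) (f2 v hv)] at this
    exact this
  have mu := fun {N : Set E} (hN : N ⊆ M) => hu.mono_measure (Measure.restrict_mono hN (le_refl μ))
  have mx := fun {N : Set E} (hN : N ⊆ M) => hξ.mono_measure (Measure.restrict_mono hN (le_refl μ))
  have t1 : (eLpNorm u 1 (μ.restrict (M \ Mc))).toReal
      ≤ (eLpNorm (u - ξ) 1 (μ.restrict (M \ Mc))).toReal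
        + (eLpNorm ξ 1 (μ.restrict (M \ Mc))).toReal := by
    rw [← ENNReal.toReal_add (f2 _ hw1) (f2 _ hξ1)]
    apply ENNReal.toReal_mono (ENNReal.add_ne_top.2 ⟨f2 _ hw1, f2 _ hξ1⟩)
    have := eLpNorm_add_le ((mu hd).sub (mx hd)) (mx hd) (le_refl (1 : ℝ≥0∞))
    rwa [sub_add_cancel] at this
  have t2 : (eLpNorm ξ 1 (μ.restrict Mc)).toReal
      ≤ (eLpNorm u 1 (μ.restrict Mc)).toReal
        + (eLpNorm (u - ξ) 1 (μ.restrict Mc)).toReal := by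
    rw [← ENNReal.toReal_add (f1 _ hu1) (f1 _ hw1)]
    apply ENNReal.toReal_mono (ENNReal.add_ne_top.2 ⟨f1 _ hu1, f1 _ hw1⟩)
    have := eLpNorm_sub_le (mu h) ((mu h).sub (mx h)) (le_refl (1 : ℝ≥0∞))
    rwa [sub_sub_cancel] at this
  have t3 : (eLpNorm ξ 1 (μ.restrict (M \ Mc))).toReal ≤ ε :=
    ENNReal.toReal_le_of_le_ofReal hε ho
  rw [sp u hu1, sp ξ hξ1, sp _ hw1]
  linarith

lemma aux_sup {E : Type*} [MeasurableSpace E] {μ : Measure E} {M Mc : Set E}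
    (h : Mc ⊆ M) (u : E → ℝ)
    (hu : AEStronglyMeasurable u (μ.restrict M)) (hu1 : eLpNorm u 1 (μ.restrict M) ≠ ⊤)
    (η A δ : ℝ) (hη : 0 ≤ η) (hA : 0 ≤ A) (hδ : 0 < δ)
    (hs : μ Mc ≤ ENNReal.ofReal η)
    (hsm : eLpNorm u ⊤ (μ.restrict M) ≤ ENNReal.ofReal A
      + ENNReal.ofReal (1 / δ) * eLpNorm u 1 (μ.restrict M)) :
    (eLpNorm u 1 (μ.restrict Mc)).toReal
      ≤ η * (A + 1 / δ * (eLpNorm u 1 (μ.restrict M)).toReal) := by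
  have h1 : eLpNorm u 1 (μ.restrict Mc) ≤ eLpNorm u ⊤ (μ.restrict Mc) * μ Mc := by
    have := eLpNorm_le_eLpNorm_mul_rpow_measure_univ (p := 1) (q := ⊤) le_top
      (hu.mono_measure (Measure.restrict_mono h (le_refl μ)))
    simpa using this
  have h2 := h1.trans (mul_le_mul' ((aux_mono (μ := μ) h u ⊤).trans hsm) hs)
  have h3 := ENNReal.toReal_mono (by finiteness) h2
  rw [ENNReal.toReal_mul, ENNReal.toReal_add (by finiteness) (by finiteness), ENNReal.toReal_mul,
    ENNReal.toReal_ofReal hη, ENNReal.toReal_ofReal hA, ENNReal.toReal_ofReal (by positivity)] at h3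
  linarith

/-- Convergence rate for the `L¹` data residual of generalized Tikhonov
regularization with `L¹` data fidelity under impulsive noise (Theorem 2.8, estimate (2.11)). -/
theorem tikhonov_residual_rate
    {X : Type*} [NormedAddCommGroup X] [NormedSpace ℝ X] [CompleteSpace X]
    {d : ℕ} (M : Set (EuclideanSpace ℝ (Fin d)))
    (hMmeas : MeasurableSet M) (hMbdd : Bornology.IsBounded M)
    (Dom : Set X) (F : X → EuclideanSpace ℝ (Fin d) → ℝ)
    (hFmeas : ∀ f ∈ Dom, AEStronglyMeasurable (F f) (volume.restrict M))
    -- `F` maps `D(F)` into `L¹(M)`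
    (hFL1 : ∀ f ∈ Dom, eLpNorm (F f) 1 (volume.restrict M) ≠ ⊤)
    -- the convex, lower semicontinuous penalty `R : X → (-∞,∞]`
    (R : X → EReal) (hRbot : ∀ f, R f ≠ ⊥)
    (hRconv : ∀ f g : X, ∀ t : ℝ, 0 ≤ t → t ≤ 1 →
      R (t • f + (1 - t) • g) ≤ ((t : ℝ) : EReal) * R f + (((1 - t : ℝ)) : EReal) * R g)
    (hRlsc : LowerSemicontinuous R)
    (fdag : X) (hfdagDom : fdag ∈ Dom) (hRfdag : R fdag ≠ ⊤)
    -- subgradient `f* ∈ ∂R(f†)`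
    (fstar : X →L[ℝ] ℝ)
    (hsub : ∀ f : X, R fdag + ((fstar (f - fdag) : ℝ) : EReal) ≤ R f)
    -- index function of the variational source condition
    (β : ℝ) (hβ : 0 < β) (φ : ℝ → ℝ)
    (hφconc : ConcaveOn ℝ (Set.Ici 0) φ) (hφmono : MonotoneOn φ (Set.Ici 0)) (hφ0 : φ 0 = 0)
    -- data of the smoothing assumption
    (δ₀ : ℝ) (hδ₀ : 0 < δ₀) (q : ℝ) (hq : 1 < q) (γ : ℝ → ℝ)
    (hγnonneg : ∀ δ : ℝ, 0 < δ → δ ≤ δ₀ → 0 ≤ γ δ)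
    (hγmono : ∀ δ₁ δ₂ : ℝ, 0 < δ₁ → δ₁ ≤ δ₂ → δ₂ ≤ δ₀ → γ δ₁ ≤ γ δ₂)
    (hγlim : Filter.Tendsto γ (nhdsWithin 0 (Set.Ioi 0)) (nhds 0))
    -- noise model
    (ξ : EuclideanSpace ℝ (Fin d) → ℝ)
    (hξmeas : AEStronglyMeasurable ξ (volume.restrict M))
    (hξL1 : eLpNorm ξ 1 (volume.restrict M) ≠ ⊤)
    (gobs : EuclideanSpace ℝ (Fin d) → ℝ) (hgobs : ∀ x, gobs x = F fdag x + ξ x)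
    (b : ℝ) (hb : 1 < b)
    (ε η : ℝ) (hε : 0 ≤ ε) (hη : 0 < η) (hηη₀ : η ≤ (b - 1) / (2 * b) * δ₀)
    (Mc : Set (EuclideanSpace ℝ (Fin d))) (hMcmeas : MeasurableSet Mc) (hMcM : Mc ⊆ M)
    (hnoise_out : eLpNorm ξ 1 (volume.restrict (M \ Mc)) ≤ ENNReal.ofReal ε)
    (hnoise_size : volume Mc ≤ ENNReal.ofReal η)
    -- the Tikhonov estimator
    (α : ℝ) (hα : 0 < α) (fhat : X) (hfhatDom : fhat ∈ Dom)
    (hfhat : ∀ f ∈ Dom,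
      (((1 / α : ℝ)) : EReal) *
          ((eLpNorm (fun x => F fhat x - gobs x) 1 (volume.restrict M) : ℝ≥0∞) : EReal)
          + R fhat
        ≤ (((1 / α : ℝ)) : EReal) *
            ((eLpNorm (fun x => F f x - gobs x) 1 (volume.restrict M) : ℝ≥0∞) : EReal)
          + R f)
    -- variational source condition (r = 1), needed only at `f = f̂_α`
    (hvsc : ((β : ℝ) : EReal) * (R fhat - R fdag - ((fstar (fhat - fdag) : ℝ) : EReal))
      ≤ (R fhat - R fdag)
        + ((φ ((eLpNorm (fun x => F fhat x - F fdag x) 1 (volume.restrict M)).toReal) : ℝ) :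
            EReal))
    -- smoothing assumption, needed only at `f = f̂_α`
    (hsmooth : ∀ δ : ℝ, 0 < δ → δ ≤ δ₀ →
      eLpNorm (fun x => F fhat x - F fdag x) ⊤ (volume.restrict M)
        ≤ ENNReal.ofReal
            (γ δ * ((R fhat - R fdag - ((fstar (fhat - fdag) : ℝ) : EReal)).toReal) ^ (1 / q))
          + ENNReal.ofReal (1 / δ) *
              eLpNorm (fun x => F fhat x - F fdag x) 1 (volume.restrict M)) :
    ((1 / b : ℝ) : EReal) *
        ((eLpNorm (fun x => F fhat x - F fdag x) 1 (volume.restrict M) : ℝ≥0∞) : EReal)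
      ≤ ((4 * (q / (q - 1)) * ε : ℝ) : EReal)
        + ((2 * (2 * η * γ ((2 * b / (b - 1)) * η)) ^ (q / (q - 1)) /
            (β * α) ^ (q / (q - 1) - 1) : ℝ) : EReal)
        + ((2 * α * (q / (q - 1)) : ℝ) : EReal) *
            ⨆ τ ∈ Set.Ici (0 : ℝ), ((φ τ - τ / (2 * b * α) : ℝ) : EReal) := by
  have hb0 : 0 < b := by linarith
  have hb1 : 0 < b - 1 := by linarith
  have hq1 : 0 < q - 1 := by linarith
  set u : EuclideanSpace ℝ (Fin d) → ℝ := fun x => F fhat x - F fdag x with hu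
  have hum : AEStronglyMeasurable u (volume.restrict M) :=
    (hFmeas _ hfhatDom).sub (hFmeas _ hfdagDom)
  have hu1 : eLpNorm u 1 (volume.restrict M) ≠ ⊤ :=
    ((eLpNorm_sub_le (hFmeas _ hfhatDom) (hFmeas _ hfdagDom) le_rfl).trans_lt
      (ENNReal.add_lt_top.2 ⟨(hFL1 _ hfhatDom).lt_top, (hFL1 _ hfdagDom).lt_top⟩)).ne
  have hw1 : eLpNorm (u - ξ) 1 (volume.restrict M) ≠ ⊤ :=
    ((eLpNorm_sub_le hum hξmeas le_rfl).trans_lt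
      (ENNReal.add_lt_top.2 ⟨hu1.lt_top, hξL1.lt_top⟩)).ne
  have hN := aux_noise hMcmeas hMcM u ξ hum hξmeas hu1 hξL1 ε hε hnoise_out
  have hT := hfhat fdag hfdagDom
  have eg1 : (fun x => F fhat x - gobs x) = u - ξ := by
    funext x; simp [hu, hgobs]; ring
  have eg2 : (fun x => F fdag x - gobs x) = -ξ := by
    funext x; simp [hgobs]
  rw [eg1, eg2, eLpNorm_neg] at hT
  have co : ∀ x : ℝ≥0∞, x ≠ ⊤ → (x : EReal) = ((x.toReal : ℝ) : EReal) := fun x hx =>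
    by rw [← EReal.toReal_coe_ennreal, EReal.coe_toReal (by simpa using hx) (by simp)]
  rw [co _ hw1, co _ hξL1] at hT
  rw [co _ hu1]
  obtain ⟨r, hr⟩ : ∃ r : ℝ, R fdag = r := ⟨_, (EReal.coe_toReal hRfdag (hRbot _)).symm⟩
  have hRhat : R fhat ≠ ⊤ := by
    intro h
    rw [h, hr, ← EReal.coe_mul, ← EReal.coe_mul, ← EReal.coe_add, EReal.coe_add_top] at hT
    exact EReal.coe_ne_top _ (top_le_iff.1 hT)
  obtain ⟨s, hs⟩ : ∃ s : ℝ, R fhat = s := ⟨_, (EReal.coe_toReal hRhat (hRbot _)).symm⟩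
  have hsb := hsub fhat
  rw [hr, hs] at hT hvsc hsb
  simp only [hr, hs] at hsmooth
  norm_cast at hT hvsc hsb
  set N := (eLpNorm u 1 (volume.restrict M)).toReal with hNdef
  set D := s - r - fstar (fhat - fdag) with hD
  have hD0 : 0 ≤ D := by linarith
  have hδpos : 0 < (2 * b / (b - 1)) * η := by positivity
  have hδle : (2 * b / (b - 1)) * η ≤ δ₀ := by
    calc (2 * b / (b - 1)) * η ≤ (2 * b / (b - 1)) * ((b - 1) / (2 * b) * δ₀) := by gcongr
      _ = δ₀ := by field_simp
  have hsm := hsmooth _ hδpos hδle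
  have hg := hγnonneg _ hδpos hδle
  have eD : ((s : EReal) - (r : EReal) - ((fstar (fhat - fdag) : ℝ) : EReal)).toReal = D := by
    norm_cast
  rw [eD] at hsm
  have hS := aux_sup hMcM u hum hu1 η _ _ hη.le (by positivity) hδpos hnoise_size hsm
  rw [← hNdef] at hS
  set G := γ ((2 * b / (b - 1)) * η) with hG
  have eδ : 2 * (η * (G * D ^ (1 / q) + 1 / ((2 * b / (b - 1)) * η) * N))
      = 2 * η * G * D ^ (1 / q) + (N - 1 / b * N) := by
    field_simp
  have hY := aux_young (2 * η * G) β α D q (by positivity) hβ hα hD0 hq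
  have hT2 : α * (s - r) ≤ (eLpNorm ξ 1 (volume.restrict M)).toReal
      - (eLpNorm (u - ξ) 1 (volume.restrict M)).toReal := by
    have := mul_le_mul_of_nonneg_left hT hα.le
    rw [mul_add, mul_add, ← mul_assoc, ← mul_assoc, mul_one_div_cancel hα.ne'] at this
    linarith
  have hV := mul_le_mul_of_nonneg_left hvsc hα.le
  have hq' : 1 ≤ q / (q - 1) := by rw [le_div_iff₀ hq1]; linarith
  have key : 1 / b * N ≤ 4 * ε + 2 * (2 * η * G) ^ (q / (q - 1)) / (β * α) ^ (q / (q - 1) - 1)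
      + 2 * α * (φ N - N / (2 * b * α)) := by
    have e1 : 2 * α * (φ N - N / (2 * b * α)) = 2 * α * φ N - 1 / b * N := by
      field_simp
    rw [e1, mul_div_assoc]
    nlinarith
  have hN0 : 0 ≤ N := ENNReal.toReal_nonneg
  have hε' : 4 * ε ≤ 4 * (q / (q - 1)) * ε := by nlinarith
  have hψ1 : ((φ N - N / (2 * b * α) : ℝ) : EReal)
      ≤ ⨆ τ ∈ Set.Ici (0 : ℝ), ((φ τ - τ / (2 * b * α) : ℝ) : EReal) :=
    le_iSup₂_of_le N hN0 le_rfl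
  have hψ0 : (0 : EReal)
      ≤ ⨆ τ ∈ Set.Ici (0 : ℝ), ((φ τ - τ / (2 * b * α) : ℝ) : EReal) :=
    le_iSup₂_of_le 0 (Set.self_mem_Ici) (by simp [hφ0])
  generalize (⨆ τ ∈ Set.Ici (0 : ℝ), ((φ τ - τ / (2 * b * α) : ℝ) : EReal)) = ψ at hψ1 hψ0
  have hc : 0 < 2 * α * (q / (q - 1)) := by positivity
  induction ψ with
  | bot => simp at hψ0
  | top =>
    rw [EReal.coe_mul_top_of_pos hc, ← EReal.coe_add, EReal.coe_add_top]
    exact le_top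
  | coe p =>
    norm_cast at hψ1 hψ0 ⊢
    have h1 : 2 * α * (φ N - N / (2 * b * α)) ≤ 2 * α * p := by gcongr
    have h2 : 2 * α * p ≤ 2 * α * (q / (q - 1)) * p := by
      have h3 : 0 ≤ 2 * α * p := by positivity
      calc 2 * α * p ≤ 2 * α * p * (q / (q - 1)) := le_mul_of_one_le_right h3 hq'
        _ = 2 * α * (q / (q - 1)) * p := by ring
    linarith
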